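/- For every n > 0, Σ_{m=n}^∞ ‖∇b(m,·)‖²_{L²} ≤ π_0 · a(2n, 0), where π_0 = 1/ω_0. -/

import Mathlib

open Filter MeasureTheory Topology

/-- `(P^n)_{k,j}` for the balanced walk on `ℤ` with transition probabilities
`P_{k,k-1} = P_{k,k+1} = ω k`, `P_{k,k} = 1 - 2 ω k`. -/
noncomputable def Ppow (ω : ℤ → ℝ) : ℕ → ℤ → ℤ → ℝ
  | 0, k, j => if k = j then 1 else 0
  | n + 1, k, j =>
      ω k * Ppow ω n (k - 1) j + (1 - 2 * ω k) * Ppow ω n k j + ω k * Ppow ω n (k + 1) j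

/-- The functions `k ↦ (P^n)_{k,j}` have finite support. -/
theorem Ppow_finite_support (ω : ℤ → ℝ) (n : ℕ) (j : ℤ) :
    (Function.support fun k => Ppow ω n k j).Finite := by
  induction n with
  | zero =>
    refine (Set.finite_singleton j).subset fun k hk => ?_
    by_contra h
    exact hk (if_neg h)
  | succ n ih =>
    have hl := ih.preimage (f := fun k : ℤ => k - 1) (fun x _ y _ h => by simpa using h)
    have hr := ih.preimage (f := fun k : ℤ => k + 1) (fun x _ y _ h => by simpa using h)
    refine ((hl.union ih).union hr).subset fun k hk => ?_
    by_contra h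
    simp only [Set.mem_union, Set.mem_preimage, Function.mem_support, not_or, not_not] at h
    exact hk (by simp [Ppow, h.1.1, h.1.2, h.2])

theorem Ppow_nonneg (ω : ℤ → ℝ) (hω : ∀ k : ℤ, 0 < ω k ∧ ω k ≤ 1 / 2) (n : ℕ) (k j : ℤ) :
    0 ≤ Ppow ω n k j := by
  induction n generalizing k with
  | zero => simp only [Ppow]; split_ifs <;> norm_num
  | succ n ih =>
    have h := hω k
    have h' : 0 ≤ 1 - 2 * ω k := by linarith
    exact add_nonneg (add_nonneg (mul_nonneg h.1.le (ih _)) (mul_nonneg h' (ih _)))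
      (mul_nonneg h.1.le (ih _))

theorem summable_mul_of_finite_support_left {f : ℤ → ℝ} (hf : f.support.Finite) (g : ℤ → ℝ) :
    Summable fun k => f k * g k :=
  summable_of_hasFiniteSupport (hf.subset (Function.support_mul_subset_left f g))

theorem finite_support_shift {f : ℤ → ℝ} (hf : f.support.Finite) :
    (Function.support fun k => f (k + 1)).Finite :=
  hf.preimage (f := fun k : ℤ => k + 1) (fun x _ y _ h => by simpa using h)

/-- Summation by parts on `ℤ`. -/
theorem tsum_grad_mul_grad {f : ℤ → ℝ} (hf : f.support.Finite) (g : ℤ → ℝ) :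
    ∑' k, (f (k + 1) - f k) * (g (k + 1) - g k)
      = ∑' k, f k * (2 * g k - g (k + 1) - g (k - 1)) := by
  have hshift : ∑' k, f (k + 1) * (g (k + 1) - g k) = ∑' k, f k * (g k - g (k - 1)) := by
    simpa using (Equiv.addRight (1 : ℤ)).tsum_eq fun k => f k * (g k - g (k - 1))
  simp only [sub_mul]
  rw [(summable_mul_of_finite_support_left (finite_support_shift hf) _).tsum_sub
    (summable_mul_of_finite_support_left hf _), hshift,
    ← (summable_mul_of_finite_support_left hf _).tsum_sub
      (summable_mul_of_finite_support_left hf _)]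
  exact tsum_congr fun k => by ring

/-- The Dirichlet form of the walk in terms of the inner product of `L²(π)`. -/
theorem tsum_grad_Ppow_eq_sub (ω : ℤ → ℝ) (hω : ∀ k, 0 < ω k) (i j : ℕ) :
    ∑' k, (Ppow ω i (k + 1) 0 - Ppow ω i k 0) * (Ppow ω j (k + 1) 0 - Ppow ω j k 0)
      = ∑' k, Ppow ω i k 0 * (Ppow ω j k 0 / ω k)
        - ∑' k, Ppow ω i k 0 * (Ppow ω (j + 1) k 0 / ω k) := by
  have hi := Ppow_finite_support ω i 0
  rw [tsum_grad_mul_grad hi fun k => Ppow ω j k 0,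
    ← (summable_mul_of_finite_support_left hi _).tsum_sub
      (summable_mul_of_finite_support_left hi _)]
  refine tsum_congr fun k => ?_
  have := (hω k).ne'
  simp only [Ppow]
  field_simp
  ring

/-- Reversibility of the walk with respect to `π = 1 / ω`. -/
theorem tsum_Ppow_mul_Ppow_div (ω : ℤ → ℝ) (hω : ∀ k, 0 < ω k) (i j : ℕ) :
    ∑' k, Ppow ω i k 0 * (Ppow ω j k 0 / ω k) = Ppow ω (i + j) 0 0 / ω 0 := by
  induction i generalizing j with
  | zero =>
    rw [tsum_eq_single 0 fun k hk => by simp [Ppow, hk]]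
    simp [Ppow]
  | succ i ih =>
    have hsymm : ∀ p q : ℕ, ∑' k, Ppow ω p k 0 * (Ppow ω q k 0 / ω k)
        = ∑' k, Ppow ω q k 0 * (Ppow ω p k 0 / ω k) :=
      fun p q => tsum_congr fun k => by ring
    have hij := tsum_grad_Ppow_eq_sub ω hω i j
    have hji := tsum_grad_Ppow_eq_sub ω hω j i
    simp only [mul_comm (Ppow ω j _ 0 - Ppow ω j _ 0)] at hji
    rw [hsymm (i + 1) j, show i + 1 + j = i + (j + 1) by ring, ← ih (j + 1)]
    linarith [hsymm i j]

theorem tsum_grad_Ppow (ω : ℤ → ℝ) (hω : ∀ k, 0 < ω k) (i j : ℕ) :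
    ∑' k, (Ppow ω i (k + 1) 0 - Ppow ω i k 0) * (Ppow ω j (k + 1) 0 - Ppow ω j k 0)
      = Ppow ω (i + j) 0 0 / ω 0 - Ppow ω (i + j + 1) 0 0 / ω 0 := by
  rw [tsum_grad_Ppow_eq_sub ω hω, tsum_Ppow_mul_Ppow_div ω hω, tsum_Ppow_mul_Ppow_div ω hω,
    add_assoc]

/-- The squared norm of the gradient of the averaged kernel, in telescoping form. -/
theorem tsum_grad_average_sq (ω : ℤ → ℝ) (hω : ∀ k, 0 < ω k) (m : ℕ) :
    ∑' k, ((Ppow ω (m + 1) (k + 1) 0 + Ppow ω m (k + 1) 0) / 2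
        - (Ppow ω (m + 1) k 0 + Ppow ω m k 0) / 2) ^ 2
      = (Ppow ω (2 * m) 0 0 + Ppow ω (2 * m + 1) 0 0) / (4 * ω 0)
        - (Ppow ω (2 * (m + 1)) 0 0 + Ppow ω (2 * (m + 1) + 1) 0 0) / (4 * ω 0) := by
  have hs : ∀ i j : ℕ, Summable fun k =>
      (Ppow ω i (k + 1) 0 - Ppow ω i k 0) * (Ppow ω j (k + 1) 0 - Ppow ω j k 0) := fun i j => by
    have hi := Ppow_finite_support ω i 0
    simp only [sub_mul]
    exact (summable_mul_of_finite_support_left (finite_support_shift hi) _).sub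
      (summable_mul_of_finite_support_left hi _)
  have hsum := (((hs (m + 1) (m + 1)).hasSum.add ((hs m (m + 1)).hasSum.mul_left 2)).add
    (hs m m).hasSum).mul_left (1 / 4)
  rw [tsum_grad_Ppow ω hω, tsum_grad_Ppow ω hω, tsum_grad_Ppow ω hω] at hsum
  rw [show m + 1 + (m + 1) = 2 * (m + 1) by ring, show m + (m + 1) = 2 * m + 1 by ring,
    show m + m = 2 * m by ring, show 2 * m + 1 + 1 = 2 * (m + 1) by ring] at hsum
  have h0 := (hω 0).ne'
  convert hsum.tsum_eq using 1
  · exact tsum_congr fun k => by ring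
  · field_simp
    ring

/-- **Lemma 4, bound for `b`.**  With `a(n,k) = (P^n)_{k,0}`,
`b(n,·) = (a(n+1,·) + a(n,·))/2` and `π₀ = 1/ω₀`, for every `n > 0`:
`Σ_{m=n}^∞ ‖∇b(m,·)‖²_{L²} ≤ π₀ a(2n,0)`. -/
theorem tail_gradient_bound_b
    (ω : ℤ → ℝ) (hω : ∀ k : ℤ, 0 < ω k ∧ ω k ≤ 1 / 2)
    (b : ℕ → ℤ → ℝ)
    (hb : ∀ (m : ℕ) (k : ℤ), b m k = (Ppow ω (m + 1) k 0 + Ppow ω m k 0) / 2)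
    (n : ℕ) (hn : 0 < n) :
    (∑' m : ℕ, ∑' k : ℤ, (b (n + m) (k + 1) - b (n + m) k) ^ 2)
      ≤ (1 / ω 0) * Ppow ω (2 * n) 0 0 := by
  have hpos : ∀ k, 0 < ω k := fun k => (hω k).1
  have h0 := hpos 0
  refine Real.tsum_le_of_sum_range_le (fun m => tsum_nonneg fun k => sq_nonneg _) fun N => ?_
  simp only [hb, tsum_grad_average_sq ω hpos]
  have htel := Finset.sum_range_sub' (fun m => (Ppow ω (2 * (n + m)) 0 0
    + Ppow ω (2 * (n + m) + 1) 0 0) / (4 * ω 0)) N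
  simp only [← add_assoc, add_zero] at htel ⊢
  rw [htel]
  have hlast : 0 ≤ (Ppow ω (2 * (n + N)) 0 0 + Ppow ω (2 * (n + N) + 1) 0 0) / (4 * ω 0) :=
    div_nonneg (add_nonneg (Ppow_nonneg ω hω _ _ _) (Ppow_nonneg ω hω _ _ _)) (by positivity)
  have hdecr : 0 ≤ Ppow ω (2 * n) 0 0 / ω 0 - Ppow ω (2 * n + 1) 0 0 / ω 0 := by
    rw [two_mul, ← tsum_grad_Ppow ω hpos]
    exact tsum_nonneg fun k => mul_self_nonneg _
  have hfirst : 0 ≤ Ppow ω (2 * n) 0 0 / ω 0 := div_nonneg (Ppow_nonneg ω hω _ _ _) h0.le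
  have hsplit : (Ppow ω (2 * n) 0 0 + Ppow ω (2 * n + 1) 0 0) / (4 * ω 0)
      = (Ppow ω (2 * n) 0 0 / ω 0 + Ppow ω (2 * n + 1) 0 0 / ω 0) / 4 := by
    field_simp
  rw [one_div_mul_eq_div]
  linarith
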